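/- Let Ĝ(n,m,p) be the random graph on the vertex set 𝒱 of G(n,m,p) obtained as follows: for each attribute w_i with |𝒱(w_i)| ≥ 2 in G(n,m,p), choose uniformly at random two vertices of 𝒱(w_i) and join them by an edge. Let p̄ = 1 − e^{−m q̂ / C(n,2)} where q̂ = 1 − (1−p)^n − n p (1−p)^{n−1}. Then the total variation distance between the distribution of the Erdős–Rényi random graph G(n,p̄) and the distribution of Ĝ(n,m,p) is at most q̂; in particular, if n p = o(1) this distance is O((np)²) = o(1). -/

import Mathlib

open MeasureTheory Filter Topology
open scoped Classical

namespace RIG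

variable {V : Type*}

/-- The number of edges of a graph. -/
noncomputable def edgeCount [Fintype V] (G : SimpleGraph V) : ℕ := G.edgeSet.ncard

/-- The number of edges of `G` with both endpoints in `S`. -/
noncomputable def edgesIn [Fintype V] (G : SimpleGraph V) (S : Finset V) : ℕ :=
  {e ∈ G.edgeSet | ∀ v ∈ e, v ∈ S}.ncard

/-- The number of edges of `G` with exactly one endpoint in `S`. -/
noncomputable def crossEdges [Fintype V] (G : SimpleGraph V) (S : Finset V) : ℕ :=
  {e ∈ G.edgeSet | (∃ v ∈ e, v ∈ S) ∧ ∃ v ∈ e, v ∉ S}.ncard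

/-- The sum of the degrees (in `G`) of the vertices of `S`. -/
noncomputable def vol [Fintype V] (G : SimpleGraph V) (S : Finset V) : ℕ :=
  ∑ v ∈ S, G.degree v

/-- The modularity score of a partition of the vertex set. -/
noncomputable def modScore [Fintype V] [DecidableEq V] (G : SimpleGraph V)
    (P : Finpartition (Finset.univ : Finset V)) : ℝ :=
  ∑ S ∈ P.parts,
    ((edgesIn G S : ℝ) / (edgeCount G : ℝ) -
      ((vol G S : ℝ) / (vol G Finset.univ : ℝ)) ^ 2)

/-- The modularity of a graph: the maximum of the modularity scores over all
partitions of the vertex set. -/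
noncomputable def modularity [Fintype V] [DecidableEq V] (G : SimpleGraph V) : ℝ :=
  ⨆ P : Finpartition (Finset.univ : Finset V), modScore G P

/-- The Bernoulli measure on `Bool` with success probability `p`. -/
noncomputable def bernoulliB (p : ℝ) : Measure Bool :=
  ENNReal.ofReal p • Measure.dirac true + ENNReal.ofReal (1 - p) • Measure.dirac false

/-- The law of the attribute assignment of the binomial random intersection graph
`G(n,m,p)`: each vertex chooses each attribute independently with probability `p`. -/
noncomputable def rigMeasure (n m : ℕ) (p : ℝ) : Measure (Fin n → Fin m → Bool) :=
  Measure.pi fun _ => Measure.pi fun _ => bernoulliB p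

/-- The intersection graph determined by an attribute assignment: two distinct vertices
are adjacent iff they share an attribute. -/
def rigGraph {n m : ℕ} (ω : Fin n → Fin m → Bool) : SimpleGraph (Fin n) :=
  SimpleGraph.fromRel fun u v => ∃ i, ω u i = true ∧ ω v i = true

/-- `q̂ = 1 - (1-p)^n - n p (1-p)^{n-1}`. -/
noncomputable def qhat (n : ℕ) (p : ℝ) : ℝ :=
  1 - (1 - p) ^ n - (n : ℝ) * p * (1 - p) ^ (n - 1)

/-- `p̄ = 1 - exp(- m q̂ / C(n,2))`. -/
noncomputable def pbar (n m : ℕ) (p : ℝ) : ℝ :=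
  1 - Real.exp (-((m : ℝ) * qhat n p) / ((n : ℝ) * ((n : ℝ) - 1) / 2))

/-- The law of the edge-indicators of the Erdős–Rényi random graph `G(n,q)`. -/
noncomputable def erMeasure (n : ℕ) (q : ℝ) : Measure (Sym2 (Fin n) → Bool) :=
  Measure.pi fun _ => bernoulliB q

/-- The graph determined by edge indicators `χ : Sym2 (Fin n) → Bool`. -/
def erGraph {n : ℕ} (χ : Sym2 (Fin n) → Bool) : SimpleGraph (Fin n) :=
  SimpleGraph.fromRel fun u v => χ s(u, v) = true

instance {n : ℕ} : MeasurableSpace (SimpleGraph (Fin n)) := ⊤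

instance {n : ℕ} : MeasurableSpace (Equiv.Perm (Fin n)) := ⊤

/-- Auxiliary randomness: for each attribute an independent uniformly random
permutation of the vertices; the first coordinate carries the attribute
assignment of `G(n,m,p)`. -/
noncomputable def hatMeasure (n m : ℕ) (p : ℝ) :
    Measure ((Fin n → Fin m → Bool) × (Fin m → Equiv.Perm (Fin n))) :=
  (rigMeasure n m p).prod
    (Measure.pi fun _ => (PMF.uniformOfFintype (Equiv.Perm (Fin n))).toMeasure)

/-- The graph `Ĝ(n,m,p)`: for each attribute `w_i` whose vertex set `𝒱(w_i)` has at
least two elements, the two vertices of `𝒱(w_i)` coming first in the (uniformly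
random) order given by the permutation attached to `w_i` — i.e. a uniformly random
pair of distinct vertices of `𝒱(w_i)` — are joined by an edge. -/
def hatGraph {n m : ℕ}
    (x : (Fin n → Fin m → Bool) × (Fin m → Equiv.Perm (Fin n))) :
    SimpleGraph (Fin n) :=
  SimpleGraph.fromRel fun u v => ∃ i : Fin m,
    x.1 u i = true ∧ x.1 v i = true ∧
      ∀ w : Fin n, x.1 w i = true → w = u ∨ w = v ∨
        (x.2 i u < x.2 i w ∧ x.2 i v < x.2 i w)

/-- The law of `Ĝ(n,m,p)`, as a measure on graphs. -/
noncomputable def hatLaw (n m : ℕ) (p : ℝ) : Measure (SimpleGraph (Fin n)) :=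
  (hatMeasure n m p).map hatGraph

/-- The law of the Erdős–Rényi random graph `G(n,q)`, as a measure on graphs. -/
noncomputable def erLaw (n : ℕ) (q : ℝ) : Measure (SimpleGraph (Fin n)) :=
  (erMeasure n q).map erGraph

/-- Total variation distance between two measures. -/
noncomputable def tvDist {α : Type*} [MeasurableSpace α] (μ ν : Measure α) : ℝ :=
  ⨆ s : Set α, |(μ s).toReal - (ν s).toReal|

/-- Binomial expectation, defined recursively. -/
noncomputable def binE (q : ℝ) : ℕ → (ℕ → ℝ) → ℝ
  | 0, h => h 0
  | m + 1, h => (1 - q) * binE q m h + q * binE q m (fun k => h (k + 1))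

lemma binE_add (q : ℝ) (m : ℕ) (g h : ℕ → ℝ) :
    binE q m (fun k => g k + h k) = binE q m g + binE q m h := by
  induction m generalizing g h with
  | zero => rfl
  | succ m ih =>
    simp only [binE]
    rw [ih g h, ih (fun k => g (k + 1)) (fun k => h (k + 1))]; ring

lemma binE_smul (q : ℝ) (m : ℕ) (c : ℝ) (h : ℕ → ℝ) :
    binE q m (fun k => c * h k) = c * binE q m h := by
  induction m generalizing h with
  | zero => rfl
  | succ m ih =>
    simp only [binE]
    rw [ih h, ih (fun k => h (k + 1))]; ring

lemma binE_const (q : ℝ) (m : ℕ) (c : ℝ) : binE q m (fun _ => c) = c := by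
  induction m with
  | zero => rfl
  | succ m ih => simp only [binE, ih]; ring

lemma binE_mono {q : ℝ} (h0 : 0 ≤ q) (h1 : q ≤ 1) (m : ℕ) {g h : ℕ → ℝ} (H : ∀ k, g k ≤ h k) :
    binE q m g ≤ binE q m h := by
  induction m generalizing g h with
  | zero => exact H 0
  | succ m ih =>
    simp only [binE]
    exact add_le_add (mul_le_mul_of_nonneg_left (ih H) (by linarith))
      (mul_le_mul_of_nonneg_left (ih fun k => H (k + 1)) h0)

lemma binE_pow (q x : ℝ) (m : ℕ) : binE q m (fun k => x ^ k) = (1 - q + q * x) ^ m := by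
  induction m with
  | zero => simp [binE]
  | succ m ih =>
    have : (fun k => x ^ (k + 1)) = fun k : ℕ => x * x ^ k := by ext k; ring
    simp only [binE]
    rw [this, binE_smul, ih]; ring

lemma binE_sum {ι : Type*} (q : ℝ) (m : ℕ) (s : Finset ι) (h : ι → ℕ → ℝ) :
    binE q m (fun k => ∑ i ∈ s, h i k) = ∑ i ∈ s, binE q m (h i) := by
  induction s using Finset.induction_on with
  | empty => simpa using binE_const q m 0
  | insert a s ha ih =>
    simp only [Finset.sum_insert ha]
    rw [binE_add, ih]

lemma binE_zero (m : ℕ) (h : ℕ → ℝ) : binE 0 m h = h 0 := by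
  induction m with
  | zero => rfl
  | succ m ih => simp [binE, ih]

lemma binE_size (q : ℝ) (m : ℕ) (g : ℕ → ℝ) :
    binE q (m + 1) (fun k => (k : ℝ) * g k) = (m + 1) * q * binE q m (fun k => g (k + 1)) := by
  induction m generalizing g with
  | zero => simp [binE]
  | succ m ih =>
    have e : (fun k : ℕ => ((k + 1 : ℕ) : ℝ) * g (k + 1))
        = fun k : ℕ => (k : ℝ) * g (k + 1) + g (k + 1) := by
      ext k; push_cast; ring
    rw [binE, e, binE_add, ih g, ih (fun k => g (k + 1))]
    simp only [binE]
    push_cast; ring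

noncomputable def poi (l : ℝ) (k : ℕ) : ℝ := Real.exp (-l) * (l ^ k / k.factorial)

lemma poi_pos {l : ℝ} (hl : 0 < l) (k : ℕ) : 0 < poi l k := by unfold poi; positivity

lemma poi_nonneg {l : ℝ} (hl : 0 ≤ l) (k : ℕ) : 0 ≤ poi l k := by unfold poi; positivity

lemma poi_succ (l : ℝ) (k : ℕ) : ((k : ℝ) + 1) * poi l (k + 1) = l * poi l k := by
  unfold poi
  rw [Nat.factorial_succ]
  have : (k.factorial : ℝ) ≠ 0 := by positivity
  push_cast
  field_simp
  ring

lemma poi_hasSum_pow (l x : ℝ) :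
    HasSum (fun k => poi l k * x ^ k) (Real.exp (-(l * (1 - x)))) := by
  have h := (NormedSpace.expSeries_div_hasSum_exp (l * x)).mul_left (Real.exp (-l))
  rw [← Real.exp_eq_exp_ℝ, ← Real.exp_add] at h
  have e1 : (fun k => poi l k * x ^ k)
      = fun k : ℕ => Real.exp (-l) * ((l * x) ^ k / (k.factorial : ℝ)) := by
    ext k; unfold poi; rw [mul_pow]; ring
  have e2 : -(l * (1 - x)) = -l + l * x := by ring
  rw [e1, e2]; exact h

lemma poi_hasSum (l : ℝ) : HasSum (poi l) 1 := by
  simpa using poi_hasSum_pow l 1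

lemma poi_mul_summable {l : ℝ} (hl : 0 ≤ l) {h : ℕ → ℝ} (h0 : ∀ k, 0 ≤ h k) (h1 : ∀ k, h k ≤ 1) :
    Summable (fun k => poi l k * h k) :=
  Summable.of_nonneg_of_le (fun k => mul_nonneg (poi_nonneg hl k) (h0 k))
    (fun k => mul_le_of_le_one_right (poi_nonneg hl k) (h1 k)) (poi_hasSum l).summable

lemma poi_head {l : ℝ} (hl : 0 ≤ l) (k : ℕ) :
    l * ∑ j ∈ Finset.range k, poi l j ≤ k * ∑ j ∈ Finset.range (k + 1), poi l j := by
  rw [Finset.sum_range_succ', mul_add, Finset.mul_sum, Finset.mul_sum]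
  have : ∑ j ∈ Finset.range k, l * poi l j ≤ ∑ j ∈ Finset.range k, (k : ℝ) * poi l (j + 1) := by
    apply Finset.sum_le_sum
    intro j hj
    rw [← poi_succ]
    apply mul_le_mul_of_nonneg_right _ (poi_nonneg hl _)
    exact_mod_cast Finset.mem_range.1 hj
  have := mul_nonneg (Nat.cast_nonneg (α := ℝ) k) (poi_nonneg hl 0)
  linarith

lemma poi_tail {l : ℝ} (hl : 0 ≤ l) (k : ℕ) :
    k * (1 - ∑ j ∈ Finset.range (k + 1), poi l j) ≤ l * (1 - ∑ j ∈ Finset.range k, poi l j) := by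
  have a := ((hasSum_nat_add_iff' (k + 1)).2 (poi_hasSum l)).mul_left (k : ℝ)
  have b := ((hasSum_nat_add_iff' k).2 (poi_hasSum l)).mul_left l
  refine hasSum_le (fun j => ?_) a b
  rw [← poi_succ]
  apply mul_le_mul_of_nonneg_right _ (poi_nonneg hl _)
  push_cast; linarith [Nat.cast_nonneg (α := ℝ) j]

/-- The solution of the Stein equation. -/
noncomputable def stein (l : ℝ) (h : ℕ → ℝ) (H : ℝ) : ℕ → ℝ
  | 0 => 0
  | k + 1 => (∑ j ∈ Finset.range (k + 1), poi l j * (h j - H)) / (l * poi l k)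

lemma stein_eq {l : ℝ} (hl : 0 < l) (h : ℕ → ℝ) (H : ℝ) (k : ℕ) :
    l * stein l h H (k + 1) - k * stein l h H k = h k - H := by
  cases k with
  | zero =>
    have := poi_pos hl 0
    simp [stein]; field_simp
  | succ k =>
    have h1 := poi_pos hl (k + 1)
    have h2 := poi_pos hl k
    have e := poi_succ l k
    simp only [stein]
    rw [Finset.sum_range_succ _ (k + 1), ← e]
    push_cast
    field_simp
    ring

lemma stein_diff {l : ℝ} (hl : 0 < l) {h : ℕ → ℝ} (h0 : ∀ k, 0 ≤ h k) (h1 : ∀ k, h k ≤ 1) (k : ℕ) :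
    stein l h (∑' j, poi l j * h j) (k + 2) - stein l h (∑' j, poi l j * h j) (k + 1) ≤ 1 / l := by
  set H := ∑' j, poi l j * h j with hH
  have e := poi_succ l k
  have p1 := poi_pos hl (k + 1)
  have hd := poi_head hl.le (k + 1)
  have tl := poi_tail hl.le (k + 1)
  have hT : ∑ j ∈ Finset.range (k + 2), poi l j * h j ≤ H :=
    (poi_mul_summable hl.le h0 h1).sum_le_tsum _ fun j _ => mul_nonneg (poi_nonneg hl.le j) (h0 j)
  have hA : 0 ≤ ∑ j ∈ Finset.range (k + 1), poi l j * h j :=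
    Finset.sum_nonneg fun j _ => mul_nonneg (poi_nonneg hl.le j) (h0 j)
  simp only [stein, mul_sub, Finset.sum_sub_distrib, ← Finset.sum_mul]
  rw [← e]
  rw [Finset.sum_range_succ _ (k + 1)] at hd tl hT ⊢
  rw [Finset.sum_range_succ _ (k + 1)]
  set A := ∑ j ∈ Finset.range (k + 1), poi l j * h j
  set F := ∑ j ∈ Finset.range (k + 1), poi l j
  set a := poi l (k + 1)
  have x0 := h0 (k + 1)
  have x1 := h1 (k + 1)
  set x := h (k + 1)
  push_cast at hd tl
  have hk : (0 : ℝ) < (k : ℝ) + 1 := by positivity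
  set K : ℝ := (k : ℝ) + 1
  obtain ⟨T, hT'⟩ : ∃ T, H = A + a * x + T := ⟨H - (A + a * x), by ring⟩
  have T0 : 0 ≤ T := by linarith
  rw [div_sub_div _ _ (by positivity) (by positivity), div_le_div_iff₀ (by positivity) hl, hT']
  have m1 := mul_nonneg hA (sub_nonneg.2 tl)
  have m2 := mul_nonneg T0 (sub_nonneg.2 hd)
  have m3 := mul_nonneg (mul_nonneg p1.le x0) (sub_nonneg.2 hd)
  have m4 := mul_nonneg (mul_nonneg p1.le (sub_nonneg.2 x1)) hk.le
  have key : K * (A + a * x - (F + a) * (A + a * x + T)) - l * (A - F * (A + a * x + T)) ≤ K * a := by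
    nlinarith
  have := mul_le_mul_of_nonneg_left key (mul_nonneg hl.le p1.le)
  nlinarith

lemma stein_chen {q : ℝ} (q0 : 0 ≤ q) (q1 : q ≤ 1) (m : ℕ) {h : ℕ → ℝ}
    (h0 : ∀ k, 0 ≤ h k) (h1 : ∀ k, h k ≤ 1) :
    binE q m h - ∑' k, poi (m * q) k * h k ≤ q := by
  rcases (mul_nonneg (Nat.cast_nonneg (α := ℝ) m) q0).eq_or_lt' with hz | hl
  · have e1 : ∑' k, poi (m * q) k * h k = h 0 := by
      rw [hz, tsum_eq_single 0]
      · simp [poi]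
      · intro k hk; simp [poi, hk]
    have e2 : binE q m h = h 0 := by
      rcases mul_eq_zero.1 hz with hm | hq
      · have : m = 0 := by exact_mod_cast hm
        subst this; rfl
      · rw [hq, binE_zero]
    rw [e1, e2]; simpa using q0
  · obtain ⟨m, rfl⟩ : ∃ m', m = m' + 1 := by
      cases m with
      | zero => simp at hl
      | succ m => exact ⟨m, rfl⟩
    set l : ℝ := ((m + 1 : ℕ) : ℝ) * q with hlq
    set H := ∑' k, poi l k * h k
    set f := stein l h H
    have e1 : h = fun k => (l * f (k + 1) + (-1) * ((k : ℝ) * f k)) + H := by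
      ext k; have := stein_eq hl h H k; simp only [f]; linarith
    have e2 : binE q (m + 1) h - H
        = l * binE q (m + 1) (fun k => f (k + 1)) - l * binE q m (fun k => f (k + 1)) := by
      conv_lhs => rw [e1]
      rw [binE_add, binE_add, binE_smul, binE_smul, binE_const, binE_size]
      rw [hlq]; push_cast; ring
    have e3 : binE q m (fun k => f (k + 2)) - binE q m (fun k => f (k + 1)) ≤ 1 / l := by
      have : binE q m (fun k => f (k + 2)) ≤ binE q m (fun k => 1 / l + f (k + 1)) :=
        binE_mono q0 q1 m fun k => by
          have := stein_diff hl h0 h1 k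
          simp only [f, H]; linarith
      rw [binE_add, binE_const] at this; linarith
    rw [e2]; simp only [binE]
    have := mul_le_mul_of_nonneg_left e3 (mul_nonneg hl.le q0)
    have e4 : l * q * (1 / l) = q := by field_simp
    rw [e4] at this
    linarith

lemma eq_of_sum_le {α : Type*} [Fintype α] [PartialOrder α] (f g : α → ℝ)
    (h : ∀ a, ∑ b ∈ Finset.univ.filter (· ≤ a), f b = ∑ b ∈ Finset.univ.filter (· ≤ a), g b)
    (a : α) : f a = g a := by
  induction a using WellFoundedLT.induction with
  | ind a ih =>
    have e : Finset.univ.filter (· ≤ a) = insert a (Finset.univ.filter (· < a)) := by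
      ext b; simp [le_iff_eq_or_lt]
    have := h a
    rw [e, Finset.sum_insert (by simp), Finset.sum_insert (by simp)] at this
    have e2 : ∑ b ∈ Finset.univ.filter (· < a), f b = ∑ b ∈ Finset.univ.filter (· < a), g b :=
      Finset.sum_congr rfl fun b hb => ih b (by simpa using hb)
    linarith

/-- Ordered pairs of distinct vertices. -/
abbrev OP (n : ℕ) := {e : Fin n × Fin n // e.1 ≠ e.2}

lemma card_OP (n : ℕ) : (Fintype.card (OP n) : ℝ) = n * (n - 1) := by
  have : Fintype.card (OP n) = n * n - n := by
    rw [Fintype.card_subtype]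
    have := Finset.offDiag_card (Finset.univ : Finset (Fin n))
    rw [Finset.card_univ, Fintype.card_fin] at this
    rw [← this]; congr 1; ext ⟨a, b⟩; simp
  rw [this, Nat.cast_sub (Nat.le_mul_self n)]; push_cast; ring

noncomputable instance {n : ℕ} : Fintype (SimpleGraph (Fin n)) := Fintype.ofFinite _

/-- The graph spanned by a sequence of pairs. -/
def tG {n k : ℕ} (t : Fin k → OP n) : SimpleGraph (Fin n) :=
  SimpleGraph.fromRel fun u v => ∃ i, (t i).1 = (u, v)

/-- Number of ordered adjacent pairs. -/
noncomputable def dc {n : ℕ} (G : SimpleGraph (Fin n)) : ℕ :=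
  (Finset.univ.filter fun e : OP n => G.Adj e.1.1 e.1.2).card

lemma tG_le {n k : ℕ} (t : Fin k → OP n) (G : SimpleGraph (Fin n)) :
    tG t ≤ G ↔ ∀ i, G.Adj (t i).1.1 (t i).1.2 := by
  constructor
  · intro h i
    apply h
    rw [tG, SimpleGraph.fromRel_adj]
    exact ⟨(t i).2, Or.inl ⟨i, rfl⟩⟩
  · intro h u v huv
    rw [tG, SimpleGraph.fromRel_adj] at huv
    rcases huv.2 with ⟨i, hi⟩ | ⟨i, hi⟩
    · have := h i; rw [hi] at this; exact this
    · have := h i; rw [hi] at this; exact this.symm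

noncomputable def kap {n : ℕ} (k : ℕ) (G : SimpleGraph (Fin n)) : ℝ :=
  ((Finset.univ.filter fun t : Fin k → OP n => tG t = G).card : ℝ) / (Fintype.card (OP n) : ℝ) ^ k

lemma kap_nonneg {n : ℕ} (k : ℕ) (G : SimpleGraph (Fin n)) : 0 ≤ kap k G := by
  unfold kap; positivity

lemma kap_sum {n : ℕ} (k : ℕ) (s : Finset (SimpleGraph (Fin n))) :
    ∑ H ∈ s, kap k H = ((Finset.univ.filter fun t : Fin k → OP n => tG t ∈ s).card : ℝ)
      / (Fintype.card (OP n) : ℝ) ^ k := by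
  unfold kap
  rw [← Finset.sum_div, ← Nat.cast_sum]
  congr 2
  rw [Finset.card_eq_sum_card_fiberwise (t := s) (f := fun t => tG t)]
  · apply Finset.sum_congr rfl
    intro H hH
    congr 1
    ext t
    simp only [Finset.mem_filter, Finset.mem_univ, true_and]
    constructor
    · rintro rfl; exact ⟨hH, rfl⟩
    · exact fun h => h.2
  · intro t ht
    simpa using ht

lemma kap_sum_le {n : ℕ} (k : ℕ) (G : SimpleGraph (Fin n)) :
    ∑ H ∈ Finset.univ.filter (· ≤ G), kap k H = ((dc G : ℝ) / Fintype.card (OP n)) ^ k := by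
  rw [kap_sum, div_pow]
  congr 1
  rw [← Nat.cast_pow, dc, ← Fintype.card_fin k, ← Fintype.card_piFinset_const]
  congr 2
  ext t
  simp [tG_le, Fintype.mem_piFinset]

lemma kap_sum_le_one {n : ℕ} (k : ℕ) (s : Finset (SimpleGraph (Fin n))) :
    ∑ H ∈ s, kap k H ≤ 1 := by
  rw [kap_sum]
  apply div_le_one_of_le₀ _ (by positivity)
  have := Finset.card_le_univ (Finset.univ.filter fun t : Fin k → OP n => tG t ∈ s)
  simp only [Fintype.card_fun, Fintype.card_fin] at this
  exact_mod_cast this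

lemma kap_le_one {n : ℕ} (k : ℕ) (G : SimpleGraph (Fin n)) : kap k G ≤ 1 := by
  simpa using kap_sum_le_one k {G}

/-- Bernoulli weights. -/
noncomputable def bb (p : ℝ) (b : Bool) : ℝ := if b then p else 1 - p

lemma sum_bb_card {n : ℕ} (p : ℝ) (g : ℕ → ℝ) :
    ∑ x : Fin n → Bool, (∏ u, bb p (x u)) * g (Finset.univ.filter fun u => x u = true).card
      = ∑ j ∈ Finset.range (n + 1), (n.choose j : ℝ) * (p ^ j * (1 - p) ^ (n - j) * g j) := by
  have h := Finset.sum_powerset_apply_card (x := (Finset.univ : Finset (Fin n)))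
    (fun j => p ^ j * (1 - p) ^ (n - j) * g j)
  rw [Finset.card_univ, Fintype.card_fin] at h
  simp only [nsmul_eq_mul] at h
  rw [← h]
  refine Finset.sum_nbij' (fun x => Finset.univ.filter fun u => x u = true)
    (fun s u => decide (u ∈ s)) ?_ ?_ ?_ ?_ ?_
  · simp
  · simp
  · intro x _; ext u; simp
  · intro s _; ext u; simp
  · intro x _
    congr 1
    simp only [bb]
    rw [Finset.prod_ite]
    simp only [Finset.prod_const]
    congr 2
    have := Finset.card_filter_add_card_filter_not (s := (Finset.univ : Finset (Fin n))) (fun u => x u = true)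
    rw [Finset.card_univ, Fintype.card_fin] at this
    omega

lemma sum_bb_one {n : ℕ} (p : ℝ) : ∑ x : Fin n → Bool, (∏ u, bb p (x u)) = 1 := by
  have := sum_bb_card (n := n) p (fun _ => 1)
  simp only [mul_one] at this
  rw [this]
  have h2 := add_pow p (1 - p) n
  simp only [add_sub_cancel, one_pow] at h2
  refine Eq.trans ?_ h2.symm
  exact Finset.sum_congr rfl fun j _ => by ring

lemma sum_bb_qhat {n : ℕ} (hn : 2 ≤ n) (p : ℝ) :
    ∑ x : Fin n → Bool, (∏ u, bb p (x u)) *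
      (if 2 ≤ (Finset.univ.filter fun u => x u = true).card then 1 else 0) = qhat n p := by
  rw [sum_bb_card p (fun j => if 2 ≤ j then 1 else 0)]
  have h2 := add_pow p (1 - p) n
  simp only [add_sub_cancel, one_pow] at h2
  obtain ⟨n, rfl⟩ : ∃ k, n = k + 2 := ⟨n - 2, by omega⟩
  rw [Finset.sum_range_succ', Finset.sum_range_succ'] at h2 ⊢
  simp [qhat] at h2 ⊢
  have : ∀ j, (((n + 2).choose (j + 1 + 1) : ℕ) : ℝ) * (p ^ (j + 1 + 1) * (1 - p) ^ (n + 2 - (j + 1 + 1)))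
    = p ^ (j + 1 + 1) * (1 - p) ^ (n + 2 - (j + 1 + 1)) * (((n + 2).choose (j + 1 + 1) : ℕ) : ℝ) := fun j => by ring
  simp at this
  simp only [this]
  linarith

/-- `u, v` are the first two chosen vertices. -/
def Fst {n : ℕ} (y : (Fin n → Bool) × Equiv.Perm (Fin n)) (u v : Fin n) : Prop :=
  y.1 u = true ∧ y.1 v = true ∧
    ∀ w : Fin n, y.1 w = true → w = u ∨ w = v ∨ (y.2 u < y.2 w ∧ y.2 v < y.2 w)

lemma Fst_exists {n : ℕ} (y : (Fin n → Bool) × Equiv.Perm (Fin n))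
    (h : 2 ≤ (Finset.univ.filter fun u => y.1 u = true).card) :
    ∃ a b, a ≠ b ∧ ∀ u v, u ≠ v → (Fst y u v ↔ (u = a ∧ v = b) ∨ (u = b ∧ v = a)) := by
  set S := Finset.univ.filter fun u => y.1 u = true with hS
  have mS : ∀ u, u ∈ S ↔ y.1 u = true := fun u => by simp [hS]
  obtain ⟨a, ha, ha'⟩ := S.exists_min_image (fun u => y.2 u) (Finset.card_pos.1 (by omega))
  obtain ⟨b, hb, hb'⟩ := (S.erase a).exists_min_image (fun u => y.2 u)
    (Finset.card_pos.1 (by rw [Finset.card_erase_of_mem ha]; omega))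
  have hba : b ≠ a := (Finset.mem_erase.1 hb).1
  have hbS := (Finset.mem_erase.1 hb).2
  have lt1 : ∀ w, y.1 w = true → w ≠ a → y.2 a < y.2 w := fun w hw hwa =>
    lt_of_le_of_ne (ha' w ((mS w).2 hw)) fun h => hwa (y.2.injective h).symm
  have lt2 : ∀ w, y.1 w = true → w ≠ a → w ≠ b → y.2 b < y.2 w := fun w hw hwa hwb =>
    lt_of_le_of_ne (hb' w (Finset.mem_erase.2 ⟨hwa, (mS w).2 hw⟩)) fun h => hwb (y.2.injective h).symm
  have ya := (mS a).1 ha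
  have yb := (mS b).1 hbS
  refine ⟨a, b, hba.symm, fun u v huv => ⟨?_, ?_⟩⟩
  · rintro ⟨hu, hv, H⟩
    have h1 : a = u ∨ a = v := by
      rcases H a ya with h | h | h
      · exact Or.inl h
      · exact Or.inr h
      · exact absurd h.1 (not_lt.2 (ha' u ((mS u).2 hu)))
    have h2 : b = u ∨ b = v := by
      rcases H b yb with h | h | h
      · exact Or.inl h
      · exact Or.inr h
      · rcases h1 with rfl | rfl
        · exact absurd h.2 (not_lt.2 (hb' v (Finset.mem_erase.2 ⟨huv.symm, (mS v).2 hv⟩)))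
        · exact absurd h.1 (not_lt.2 (hb' u (Finset.mem_erase.2 ⟨huv, (mS u).2 hu⟩)))
    grind
  · have : ∀ w, y.1 w = true → w ≠ a → w ≠ b → y.2 a < y.2 w ∧ y.2 b < y.2 w :=
      fun w h1 h2 h3 => ⟨lt1 w h1 h2, lt2 w h1 h2 h3⟩
    rintro (⟨rfl, rfl⟩ | ⟨rfl, rfl⟩)
    · refine ⟨ya, yb, fun w hw => ?_⟩
      have := this w hw
      tauto
    · refine ⟨yb, ya, fun w hw => ?_⟩
      have := this w hw
      tauto

lemma Fst_card {n : ℕ} {y : (Fin n → Bool) × Equiv.Perm (Fin n)} {u v : Fin n} (huv : u ≠ v)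
    (h : Fst y u v) : 2 ≤ (Finset.univ.filter fun u => y.1 u = true).card := by
  rw [← Finset.card_pair huv]
  apply Finset.card_le_card
  intro w hw
  rcases Finset.mem_insert.1 hw with rfl | hw
  · simpa using h.1
  · rw [Finset.mem_singleton.1 hw]; simpa using h.2.1

lemma Fst_sum_one {n : ℕ} (y : (Fin n → Bool) × Equiv.Perm (Fin n)) :
    ∑ e : OP n, (if Fst y e.1.1 e.1.2 then (1 : ℝ) else 0)
      = 2 * (if 2 ≤ (Finset.univ.filter fun u => y.1 u = true).card then 1 else 0) := by
  split_ifs with h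
  · obtain ⟨a, b, hab, H⟩ := Fst_exists y h
    rw [Finset.sum_boole]
    have : (Finset.univ.filter fun e : OP n => Fst y e.1.1 e.1.2)
        = {⟨(a, b), hab⟩, ⟨(b, a), hab.symm⟩} := by
      ext ⟨⟨u, v⟩, huv⟩
      simp [H u v huv]
    rw [this, Finset.card_pair (by simp [hab])]; norm_num
  · rw [mul_zero]
    apply Finset.sum_eq_zero
    intro e _
    rw [if_neg fun h' => h (Fst_card e.2 h')]

def Good {n : ℕ} (G : SimpleGraph (Fin n)) (y : (Fin n → Bool) × Equiv.Perm (Fin n)) : Prop :=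
  ∀ u v, u ≠ v → Fst y u v → G.Adj u v

lemma Fst_sum_good {n : ℕ} (G : SimpleGraph (Fin n)) (y : (Fin n → Bool) × Equiv.Perm (Fin n)) :
    ∑ e ∈ Finset.univ.filter (fun e : OP n => ¬ G.Adj e.1.1 e.1.2),
      (if Fst y e.1.1 e.1.2 then (1 : ℝ) else 0)
      = 2 * (1 - if Good G y then 1 else 0) := by
  split_ifs with h
  · rw [sub_self, mul_zero]
    apply Finset.sum_eq_zero
    intro e he
    rw [if_neg fun h' => (Finset.mem_filter.1 he).2 (h _ _ e.2 h')]
  · unfold Good at h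
    push Not at h
    obtain ⟨u, v, huv, hf, hadj⟩ := h
    obtain ⟨a, b, hab, H⟩ := Fst_exists y (Fst_card huv hf)
    have nadj : ¬ G.Adj a b := by
      rcases (H u v huv).1 hf with ⟨rfl, rfl⟩ | ⟨rfl, rfl⟩
      · exact hadj
      · exact fun h => hadj h.symm
    rw [Finset.sum_boole, Finset.filter_filter]
    have : (Finset.univ.filter fun e : OP n => ¬ G.Adj e.1.1 e.1.2 ∧ Fst y e.1.1 e.1.2)
        = {⟨(a, b), hab⟩, ⟨(b, a), hab.symm⟩} := by
      ext ⟨⟨u, v⟩, huv⟩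
      simp only [Finset.mem_filter, Finset.mem_univ, true_and, H u v huv, Finset.mem_insert,
        Finset.mem_singleton, Subtype.mk.injEq, Prod.mk.injEq]
      constructor
      · exact fun h => h.2
      · rintro (⟨rfl, rfl⟩ | ⟨rfl, rfl⟩)
        · exact ⟨nadj, by simp⟩
        · exact ⟨fun h => nadj h.symm, by simp⟩
    rw [this, Finset.card_pair (by simp [hab])]; norm_num

noncomputable def wt {n : ℕ} (p : ℝ) (y : (Fin n → Bool) × Equiv.Perm (Fin n)) : ℝ :=
  (∏ u, bb p (y.1 u)) * (Fintype.card (Equiv.Perm (Fin n)) : ℝ)⁻¹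

lemma wt_sum {n : ℕ} (p : ℝ) (g : (Fin n → Bool) → ℝ) :
    ∑ y : (Fin n → Bool) × Equiv.Perm (Fin n), wt p y * g y.1
      = ∑ x : Fin n → Bool, (∏ u, bb p (x u)) * g x := by
  rw [Fintype.sum_prod_type]
  apply Finset.sum_congr rfl
  intro x _
  have : (Fintype.card (Equiv.Perm (Fin n)) : ℝ) ≠ 0 := by
    exact_mod_cast Fintype.card_ne_zero
  simp only [wt, Finset.sum_const, Finset.card_univ, nsmul_eq_mul]
  field_simp

/-- Probability that the pair `e` is chosen. -/
noncomputable def pc {n : ℕ} (p : ℝ) (e : OP n) : ℝ :=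
  ∑ y : (Fin n → Bool) × Equiv.Perm (Fin n), wt p y * (if Fst y e.1.1 e.1.2 then 1 else 0)

lemma pc_const {n : ℕ} (p : ℝ) (e e' : OP n) : pc p e = pc p e' := by
  obtain ⟨⟨a, b⟩, hab⟩ := e
  obtain ⟨⟨a', b'⟩, hab'⟩ := e'
  simp only at hab hab'
  obtain ⟨τ, ha, hb⟩ : ∃ τ : Equiv.Perm (Fin n), τ a = a' ∧ τ b = b' := by
    have h1 : a' ≠ Equiv.swap a a' b := by
      intro h
      have := (Equiv.swap a a').injective ((Equiv.swap_apply_left a a').trans h)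
      exact hab this
    refine ⟨Equiv.swap (Equiv.swap a a' b) b' * Equiv.swap a a', ?_, ?_⟩
    · simp [Equiv.swap_apply_of_ne_of_ne h1 hab']
    · simp
  unfold pc
  refine Fintype.sum_equiv (Equiv.prodCongr (Equiv.arrowCongr τ (Equiv.refl Bool))
    (Equiv.mulRight τ⁻¹)) _ _ ?_
  rintro ⟨x, σ⟩
  have e1 : wt p ((Equiv.prodCongr (Equiv.arrowCongr τ (Equiv.refl Bool))
    (Equiv.mulRight τ⁻¹)) (x, σ)) = wt p (x, σ) := by
    simp only [wt]
    congr 1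
    exact Equiv.prod_comp τ.symm (fun u => bb p (x u))
  have e2 : Fst ((Equiv.prodCongr (Equiv.arrowCongr τ (Equiv.refl Bool))
    (Equiv.mulRight τ⁻¹)) (x, σ)) a' b' ↔ Fst (x, σ) a b := by
    subst ha hb
    unfold Fst
    rw [← τ.forall_congr_right]
    simp
  rw [e1]
  simp only [e2]

lemma pc_eq {n : ℕ} (hn : 2 ≤ n) (p : ℝ) (e : OP n) :
    pc p e * Fintype.card (OP n) = 2 * qhat n p := by
  have h1 : ∑ e' : OP n, pc p e' = pc p e * Fintype.card (OP n) := by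
    rw [Finset.sum_congr rfl fun e' _ => pc_const p e' e]
    simp [mul_comm]
  rw [← h1]
  unfold pc
  rw [Finset.sum_comm]
  simp only [← Finset.mul_sum, Fst_sum_one]
  rw [← sum_bb_qhat hn p, ← wt_sum, Finset.mul_sum]
  exact Finset.sum_congr rfl fun y _ => by ring

lemma dc_compl {n : ℕ} (G : SimpleGraph (Fin n)) :
    dc G + (Finset.univ.filter fun e : OP n => ¬ G.Adj e.1.1 e.1.2).card = Fintype.card (OP n) := by
  rw [dc, Finset.card_filter_add_card_filter_not]; rfl

lemma wt_good {n : ℕ} (hn : 2 ≤ n) (p : ℝ) (G : SimpleGraph (Fin n)) :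
    ∑ y : (Fin n → Bool) × Equiv.Perm (Fin n), (if Good G y then wt p y else 0)
      = 1 - qhat n p + qhat n p * ((dc G : ℝ) / Fintype.card (OP n)) := by
  have one : ∑ y : (Fin n → Bool) × Equiv.Perm (Fin n), wt p y = 1 := by
    simpa [sum_bb_one] using wt_sum (n := n) p (fun _ => 1)
  let e0 : OP n := ⟨(⟨0, by omega⟩, ⟨1, by omega⟩), by simp⟩
  have hc : (Fintype.card (OP n) : ℝ) ≠ 0 := by
    have : Nonempty (OP n) := ⟨e0⟩
    exact_mod_cast Fintype.card_ne_zero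
  have h1 : ∑ e ∈ Finset.univ.filter (fun e : OP n => ¬ G.Adj e.1.1 e.1.2), pc p e
      = 2 * (1 - ∑ y : (Fin n → Bool) × Equiv.Perm (Fin n), (if Good G y then wt p y else 0)) := by
    unfold pc
    rw [Finset.sum_comm]
    simp only [← Finset.mul_sum, Fst_sum_good]
    rw [show (1 - ∑ y : (Fin n → Bool) × Equiv.Perm (Fin n), (if Good G y then wt p y else 0))
      = (∑ y : (Fin n → Bool) × Equiv.Perm (Fin n), wt p y)
        - ∑ y : (Fin n → Bool) × Equiv.Perm (Fin n), (if Good G y then wt p y else 0) by rw [one],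
      ← Finset.sum_sub_distrib, Finset.mul_sum]
    refine Finset.sum_congr rfl fun y _ => ?_
    split_ifs <;> ring
  rw [Finset.sum_congr rfl fun e' _ => pc_const p e' e0, Finset.sum_const, nsmul_eq_mul] at h1
  have h2 := pc_eq hn p e0
  have h3 : (dc G : ℝ) + ((Finset.univ.filter fun e : OP n => ¬ G.Adj e.1.1 e.1.2).card : ℝ)
    = Fintype.card (OP n) := by exact_mod_cast dc_compl G
  have h4 : pc p e0 = 2 * qhat n p / Fintype.card (OP n) := by
    rw [← h2]; field_simp
  rw [h4] at h1
  set N : ℝ := ((Fintype.card (OP n) : ℕ) : ℝ)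
  have h5 : ((Finset.univ.filter fun e : OP n => ¬ G.Adj e.1.1 e.1.2).card : ℝ) = N - dc G := by
    linarith
  rw [h5] at h1
  have h6 : (N - dc G) * (2 * qhat n p / N) = 2 * (qhat n p - qhat n p * (dc G / N)) := by
    field_simp
  linarith

lemma qhat_of_lt {n : ℕ} (hn : n < 2) (p : ℝ) : qhat n p = 0 := by
  interval_cases n <;> simp [qhat]

lemma bb_nonneg {p : ℝ} (h0 : 0 ≤ p) (h1 : p ≤ 1) (b : Bool) : 0 ≤ bb p b := by
  unfold bb; split_ifs <;> linarith

lemma qhat_nonneg {n : ℕ} {p : ℝ} (h0 : 0 ≤ p) (h1 : p ≤ 1) : 0 ≤ qhat n p := by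
  rcases lt_or_ge n 2 with hn | hn
  · rw [qhat_of_lt hn]
  · rw [← sum_bb_qhat hn]
    refine Finset.sum_nonneg fun x _ => mul_nonneg
      (Finset.prod_nonneg fun u _ => bb_nonneg h0 h1 _) (by split_ifs <;> norm_num)

lemma qhat_le_one {n : ℕ} {p : ℝ} (h0 : 0 ≤ p) (h1 : p ≤ 1) : qhat n p ≤ 1 := by
  have h : 0 ≤ 1 - p := by linarith
  unfold qhat
  have := pow_nonneg h n
  have : 0 ≤ (n : ℝ) * p * (1 - p) ^ (n - 1) := by positivity
  linarith

lemma qhat_le_sq {n : ℕ} {p : ℝ} (h0 : 0 ≤ p) (h1 : p ≤ 1) : qhat n p ≤ ((n : ℝ) * p) ^ 2 := by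
  have b : ∀ k : ℕ, 1 - k * p ≤ (1 - p) ^ k := fun k => by
    have := one_add_mul_le_pow (a := -p) (by linarith) k
    rw [← sub_eq_add_neg] at this
    linarith
  unfold qhat
  have b1 := b n
  have b2 := b (n - 1)
  have hk : ((n - 1 : ℕ) : ℝ) ≤ n := by exact_mod_cast Nat.sub_le n 1
  have hk2 := mul_le_mul_of_nonneg_right hk h0
  have hnp : 0 ≤ (n : ℝ) * p := by positivity
  have := mul_le_mul_of_nonneg_left (show 1 - (n : ℝ) * p ≤ (1 - p) ^ (n - 1) by linarith) hnp
  nlinarith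

lemma bernoulliB_true (p : ℝ) : bernoulliB p {true} = ENNReal.ofReal p := by
  simp [bernoulliB]

lemma bernoulliB_false (p : ℝ) : bernoulliB p {false} = ENNReal.ofReal (1 - p) := by
  simp [bernoulliB]

lemma bernoulliB_prob {p : ℝ} (h0 : 0 ≤ p) (h1 : p ≤ 1) : IsProbabilityMeasure (bernoulliB p) := by
  constructor
  simp [bernoulliB]
  rw [← ENNReal.ofReal_add h0 (by linarith)]
  simp

lemma bernoulliB_real {p : ℝ} (h0 : 0 ≤ p) (h1 : p ≤ 1) (b : Bool) :
    (bernoulliB p {b}).toReal = bb p b := by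
  cases b
  · rw [bernoulliB_false, ENNReal.toReal_ofReal (by linarith)]; simp [bb]
  · rw [bernoulliB_true, ENNReal.toReal_ofReal h0]; simp [bb]

instance {n : ℕ} : DiscreteMeasurableSpace (SimpleGraph (Fin n)) := ⟨fun _ => trivial⟩

instance {n : ℕ} : DiscreteMeasurableSpace (Equiv.Perm (Fin n)) := ⟨fun _ => trivial⟩

lemma erLaw_prob (n : ℕ) {q : ℝ} (h0 : 0 ≤ q) (h1 : q ≤ 1) : IsProbabilityMeasure (erLaw n q) := by
  have := bernoulliB_prob h0 h1
  unfold erLaw erMeasure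
  exact Measure.isProbabilityMeasure_map (Measurable.of_discrete).aemeasurable

lemma hatMeasure_prob (n m : ℕ) {p : ℝ} (h0 : 0 ≤ p) (h1 : p ≤ 1) :
    IsProbabilityMeasure (hatMeasure n m p) := by
  have := bernoulliB_prob h0 h1
  unfold hatMeasure rigMeasure
  infer_instance

lemma hatLaw_prob (n m : ℕ) {p : ℝ} (h0 : 0 ≤ p) (h1 : p ≤ 1) :
    IsProbabilityMeasure (hatLaw n m p) := by
  have := hatMeasure_prob n m h0 h1
  unfold hatLaw
  exact Measure.isProbabilityMeasure_map (Measurable.of_discrete).aemeasurable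

lemma dc_eq {n : ℕ} (G : SimpleGraph (Fin n)) : dc G = 2 * G.edgeFinset.card := by
  rw [← SimpleGraph.sum_degrees_eq_twice_card_edges, ← SimpleGraph.dart_card_eq_sum_degrees, dc,
    ← Fintype.card_subtype]
  refine Fintype.card_congr ⟨fun e => ⟨e.1.1, e.2⟩, fun d => ⟨⟨d.toProd, d.adj.ne⟩, d.adj⟩, ?_, ?_⟩
  · intro e; rfl
  · intro d; rfl

lemma er_le {n : ℕ} (χ : Sym2 (Fin n) → Bool) (G : SimpleGraph (Fin n)) :
    erGraph χ ≤ G ↔ ∀ e, e ∈ Gᶜ.edgeFinset → χ e = false := by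
  constructor
  · intro h e
    induction e with
    | h u v =>
      intro he
      simp only [SimpleGraph.mem_edgeFinset, SimpleGraph.mem_edgeSet, SimpleGraph.compl_adj] at he
      by_contra hc
      apply he.2
      apply h
      rw [erGraph, SimpleGraph.fromRel_adj]
      exact ⟨he.1, Or.inl (by simpa using hc)⟩
  · intro h u v huv
    rw [erGraph, SimpleGraph.fromRel_adj] at huv
    by_contra hc
    have := h s(u, v) (by simp [SimpleGraph.compl_adj, huv.1, hc])
    rw [Sym2.eq_swap (a := v)] at huv
    simp [this] at huv

lemma er_Iic {n : ℕ} {q : ℝ} (h0 : 0 ≤ q) (h1 : q ≤ 1) (G : SimpleGraph (Fin n)) :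
    (erLaw n q).real {H | H ≤ G} = (1 - q) ^ Gᶜ.edgeFinset.card := by
  have := bernoulliB_prob h0 h1
  unfold erLaw erMeasure
  rw [map_measureReal_apply Measurable.of_discrete (MeasurableSet.of_discrete)]
  have e : erGraph ⁻¹' {H | H ≤ G} = Set.pi Set.univ
      (fun e : Sym2 (Fin n) => if e ∈ Gᶜ.edgeFinset then {false} else Set.univ) := by
    ext χ
    simp only [Set.mem_preimage, Set.mem_ofPred_eq, er_le, Set.mem_univ_pi]
    refine forall_congr' fun e => ?_
    split_ifs with h <;> simp [h]
  rw [e, Measure.real, Measure.pi_pi, ENNReal.toReal_prod]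
  have : ∀ e : Sym2 (Fin n), ((bernoulliB q) (if e ∈ Gᶜ.edgeFinset then {false} else Set.univ)).toReal
      = if e ∈ Gᶜ.edgeFinset then 1 - q else 1 := by
    intro e
    split_ifs
    · rw [bernoulliB_real h0 h1]; simp [bb]
    · rw [measure_univ]; simp
  simp only [this]
  rw [Finset.prod_ite, Finset.prod_const, Finset.prod_const_one, mul_one, Finset.filter_mem_eq_inter,
    Finset.univ_inter]

lemma card_OP_pos {n : ℕ} (hn : 2 ≤ n) : (0 : ℝ) < Fintype.card (OP n) := by
  rw [card_OP]
  have : (2 : ℝ) ≤ n := by exact_mod_cast hn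
  nlinarith

lemma pbar_mem {n m : ℕ} {p : ℝ} (h0 : 0 ≤ p) (h1 : p ≤ 1) : 0 ≤ pbar n m p ∧ pbar n m p ≤ 1 := by
  unfold pbar
  constructor
  · rw [sub_nonneg, Real.exp_le_one_iff]
    apply div_nonpos_of_nonpos_of_nonneg
    · have := mul_nonneg (Nat.cast_nonneg (α := ℝ) m) (qhat_nonneg (n := n) h0 h1)
      linarith
    · rw [← card_OP]; positivity
  · linarith [Real.exp_pos (-((m : ℝ) * qhat n p) / ((n : ℝ) * ((n : ℝ) - 1) / 2))]

lemma er_pbar_Iic {n m : ℕ} (hn : 2 ≤ n) {p : ℝ} (h0 : 0 ≤ p) (h1 : p ≤ 1) (G : SimpleGraph (Fin n)) :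
    (erLaw n (pbar n m p)).real {H | H ≤ G}
      = Real.exp (-((m : ℝ) * qhat n p * (1 - (dc G : ℝ) / Fintype.card (OP n)))) := by
  obtain ⟨b0, b1⟩ := pbar_mem (n := n) (m := m) h0 h1
  rw [er_Iic b0 b1]
  have h2 : (dc G : ℝ) + 2 * (Gᶜ.edgeFinset.card : ℝ) = Fintype.card (OP n) := by
    rw [← dc_compl G]
    push_cast
    congr 1
    have : (2 * (Gᶜ.edgeFinset.card : ℝ)) = dc Gᶜ := by rw [dc_eq]; push_cast; congr!
    rw [this, dc]
    congr 2
    ext e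
    simp [SimpleGraph.compl_adj, e.2]
  have hN := card_OP_pos hn
  unfold pbar
  rw [sub_sub_cancel, ← Real.exp_nat_mul, ← card_OP]
  congr 1
  set N : ℝ := ((Fintype.card (OP n) : ℕ) : ℝ)
  have : (dc G : ℝ) = N - 2 * (Gᶜ.edgeFinset.card : ℝ) := by linarith
  rw [this]
  field_simp
  ring

lemma hat_le {n m : ℕ} (x : (Fin n → Fin m → Bool) × (Fin m → Equiv.Perm (Fin n)))
    (G : SimpleGraph (Fin n)) :
    hatGraph x ≤ G ↔ ∀ i, Good G (fun u => x.1 u i, x.2 i) := by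
  constructor
  · intro h i u v huv hf
    apply h
    rw [hatGraph, SimpleGraph.fromRel_adj]
    exact ⟨huv, Or.inl ⟨i, hf⟩⟩
  · intro h u v huv
    rw [hatGraph, SimpleGraph.fromRel_adj] at huv
    rcases huv.2 with ⟨i, hi⟩ | ⟨i, hi⟩
    · exact h i u v huv.1 hi
    · exact (h i v u huv.1.symm hi).symm

lemma hatMeasure_singleton {n m : ℕ} {p : ℝ} (h0 : 0 ≤ p) (h1 : p ≤ 1)
    (x : (Fin n → Fin m → Bool) × (Fin m → Equiv.Perm (Fin n))) :
    (hatMeasure n m p).real {x} = ∏ i, wt p (fun u => x.1 u i, x.2 i) := by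
  have := bernoulliB_prob h0 h1
  obtain ⟨ω, σ⟩ := x
  unfold hatMeasure rigMeasure
  rw [← Set.singleton_prod_singleton, Measure.real, Measure.prod_prod, Measure.pi_singleton,
    Measure.pi_singleton]
  simp only [Measure.pi_singleton, ENNReal.toReal_mul, ENNReal.toReal_prod, bernoulliB_real h0 h1]
  rw [Finset.prod_comm, ← Finset.prod_mul_distrib]
  refine Finset.prod_congr rfl fun i _ => ?_
  unfold wt
  rw [PMF.toMeasure_apply_singleton _ _ (MeasurableSet.of_discrete)]
  simp

lemma hat_Iic {n m : ℕ} (hn : 2 ≤ n) {p : ℝ} (h0 : 0 ≤ p) (h1 : p ≤ 1) (G : SimpleGraph (Fin n)) :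
    (hatLaw n m p).real {H | H ≤ G}
      = (1 - qhat n p + qhat n p * ((dc G : ℝ) / Fintype.card (OP n))) ^ m := by
  have := hatMeasure_prob n m h0 h1
  unfold hatLaw
  rw [map_measureReal_apply Measurable.of_discrete (MeasurableSet.of_discrete)]
  let A : Finset ((Fin n → Fin m → Bool) × (Fin m → Equiv.Perm (Fin n))) :=
    Finset.univ.filter fun x => ∀ i, Good G (fun u => x.1 u i, x.2 i)
  have e : hatGraph (m := m) ⁻¹' {H | H ≤ G} = (A : Set _) := by
    ext x; simp [hat_le, A]
  rw [e, ← sum_measureReal_singleton, ← wt_good hn, Fintype.sum_pow, Finset.sum_filter]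
  refine Fintype.sum_equiv
    ⟨fun x i => (fun u => x.1 u i, x.2 i), fun y => (fun u i => (y i).1 u, fun i => (y i).2),
      fun x => rfl, fun y => rfl⟩ _ _ ?_
  intro x
  simp only [Equiv.coe_fn_mk]
  rw [hatMeasure_singleton h0 h1]
  split_ifs with h
  · exact Finset.prod_congr rfl fun i _ => by rw [if_pos (h i)]
  · push Not at h
    obtain ⟨i, hi⟩ := h
    rw [Finset.prod_eq_zero (Finset.mem_univ i)]
    rw [if_neg hi]

lemma real_Iic {n : ℕ} (μ : Measure (SimpleGraph (Fin n))) [IsFiniteMeasure μ] (G : SimpleGraph (Fin n)) :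
    ∑ H ∈ Finset.univ.filter (· ≤ G), μ.real {H} = μ.real {H | H ≤ G} := by
  rw [sum_measureReal_singleton]; simp

lemma er_point {n m : ℕ} (hn : 2 ≤ n) {p : ℝ} (h0 : 0 ≤ p) (h1 : p ≤ 1) (G : SimpleGraph (Fin n)) :
    (erLaw n (pbar n m p)).real {G} = ∑' k, poi (m * qhat n p) k * kap k G := by
  obtain ⟨b0, b1⟩ := pbar_mem (n := n) (m := m) h0 h1
  have := erLaw_prob n b0 b1
  have hl : 0 ≤ (m : ℝ) * qhat n p := mul_nonneg (Nat.cast_nonneg _) (qhat_nonneg h0 h1)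
  refine eq_of_sum_le (fun G => (erLaw n (pbar n m p)).real {G})
    (fun G => ∑' k, poi (m * qhat n p) k * kap k G) (fun G => ?_) G
  rw [real_Iic, er_pbar_Iic hn h0 h1, ← Summable.tsum_finsetSum
    (fun H _ => poi_mul_summable hl (fun k => kap_nonneg k H) (fun k => kap_le_one k H))]
  simp only [← Finset.mul_sum, kap_sum_le]
  exact (poi_hasSum_pow _ _).tsum_eq.symm

lemma hat_point {n m : ℕ} (hn : 2 ≤ n) {p : ℝ} (h0 : 0 ≤ p) (h1 : p ≤ 1) (G : SimpleGraph (Fin n)) :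
    (hatLaw n m p).real {G} = binE (qhat n p) m (fun k => kap k G) := by
  have := hatLaw_prob n m h0 h1
  refine eq_of_sum_le (fun G => (hatLaw n m p).real {G})
    (fun G => binE (qhat n p) m (fun k => kap k G)) (fun G => ?_) G
  rw [real_Iic, hat_Iic hn h0 h1, ← binE_sum]
  simp only [kap_sum_le]
  exact (binE_pow _ _ _).symm

lemma one_sided {n m : ℕ} (hn : 2 ≤ n) {p : ℝ} (h0 : 0 ≤ p) (h1 : p ≤ 1)
    (s : Set (SimpleGraph (Fin n))) :
    (hatLaw n m p).real s - (erLaw n (pbar n m p)).real s ≤ qhat n p := by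
  obtain ⟨b0, b1⟩ := pbar_mem (n := n) (m := m) h0 h1
  have := erLaw_prob n b0 b1
  have := hatLaw_prob n m h0 h1
  have hl : 0 ≤ (m : ℝ) * qhat n p := mul_nonneg (Nat.cast_nonneg _) (qhat_nonneg h0 h1)
  have e : s = ((Finset.univ.filter (· ∈ s) : Finset _) : Set (SimpleGraph (Fin n))) := by simp
  rw [e, ← sum_measureReal_singleton, ← sum_measureReal_singleton]
  simp only [er_point hn h0 h1, hat_point hn h0 h1]
  rw [← binE_sum, ← Summable.tsum_finsetSum
    (fun H _ => poi_mul_summable hl (fun k => kap_nonneg k H) (fun k => kap_le_one k H))]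
  simp only [← Finset.mul_sum]
  exact stein_chen (qhat_nonneg h0 h1) (qhat_le_one h0 h1) m
    (fun k => Finset.sum_nonneg fun H _ => kap_nonneg k H) (fun k => kap_sum_le_one k _)

lemma tv_le {n m : ℕ} {p : ℝ} (h0 : 0 ≤ p) (h1 : p ≤ 1) :
    tvDist (erLaw n (pbar n m p)) (hatLaw n m p) ≤ qhat n p := by
  obtain ⟨b0, b1⟩ := pbar_mem (n := n) (m := m) h0 h1
  have := erLaw_prob n b0 b1
  have := hatLaw_prob n m h0 h1
  unfold tvDist
  refine ciSup_le fun s => ?_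
  rcases lt_or_ge n 2 with hn | hn
  · have : Subsingleton (Fin n) := by
      interval_cases n <;> infer_instance
    rw [qhat_of_lt hn]
    have hs : Subsingleton (SimpleGraph (Fin n)) :=
      ⟨fun G H => by ext u v; simp [Subsingleton.elim u v]⟩
    rcases s.eq_empty_or_nonempty with h | h
    · simp [h]
    · rw [Subsingleton.eq_univ_of_nonempty h]
      simp
  · have a := one_sided (m := m) hn h0 h1 s
    have b := one_sided (m := m) hn h0 h1 sᶜ
    rw [probReal_compl_eq_one_sub MeasurableSet.of_discrete,
      probReal_compl_eq_one_sub MeasurableSet.of_discrete] at b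
    change |(erLaw n (pbar n m p)).real s - (hatLaw n m p).real s| ≤ _
    rw [abs_le]
    constructor <;> linarith

/-- Lemma (Lem:Equivalence): the total variation distance between the law of
`G(n,p̄)` and the law of `Ĝ(n,m,p)` is at most `q̂`; in particular, if `np = o(1)`,
this distance is `O((np)²) = o(1)`. -/
theorem tv_distance_er_hat :
    (∀ (n m : ℕ) (p : ℝ), 0 ≤ p → p ≤ 1 →
      tvDist (erLaw n (pbar n m p)) (hatLaw n m p) ≤ qhat n p) ∧
    ∀ (m : ℕ → ℕ) (p : ℕ → ℝ), (∀ n, 0 ≤ p n ∧ p n ≤ 1) →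
      Tendsto (fun n : ℕ => (n : ℝ) * p n) atTop (nhds 0) →
      (∃ C : ℝ, ∀ᶠ n : ℕ in atTop,
        tvDist (erLaw n (pbar n (m n) (p n))) (hatLaw n (m n) (p n)) ≤
          C * ((n : ℝ) * p n) ^ 2) ∧
      Tendsto (fun n : ℕ =>
          tvDist (erLaw n (pbar n (m n) (p n))) (hatLaw n (m n) (p n)))
        atTop (nhds 0) := by
  refine ⟨fun n m p h0 h1 => tv_le h0 h1, fun m p hp hlim => ?_⟩
  have hb : ∀ n, tvDist (erLaw n (pbar n (m n) (p n))) (hatLaw n (m n) (p n))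
      ≤ ((n : ℝ) * p n) ^ 2 := fun n =>
    (tv_le (hp n).1 (hp n).2).trans (qhat_le_sq (hp n).1 (hp n).2)
  refine ⟨⟨1, Filter.Eventually.of_forall fun n => by simpa using hb n⟩, ?_⟩
  refine squeeze_zero (fun n => Real.iSup_nonneg fun s => abs_nonneg _) hb ?_
  simpa using hlim.pow 2

end RIG
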